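/- arXiv:1304.4862 — 3 statements merged into one kernel-verified Lean document; each statement's English description precedes it below -/
import Mathlib

section
/- Let H be a finite group and ℋ a separable complex Hilbert space. Equip the set Hom(H,U(ℋ)) of group homomorphisms H → U(ℋ) with the metric d(α,β) = max_{h∈H} ‖α(h) − β(h)‖ (operator norm). Then any two homomorphisms lying in distinct orbits of the conjugation action of U(ℋ) on Hom(H,U(ℋ)) have distance at least 1/|H|; consequently each conjugation orbit {u α u⁻¹ := (h ↦ u·α(h)·u⁻¹) | u ∈ U(ℋ)} is both open and closed in Hom(H,U(ℋ)), and Hom(H,U(ℋ)) is homeomorphic to the disjoint union of its conjugation orbits. -/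
/-- The space of group homomorphisms `H → G`, realized as the subtype of multiplicative
maps inside the space `H → G` of all maps; for a finite group `H` and a metrizable group
`G` the induced (product/subspace) topology is the topology of the supremum metric
`d(α,β) = max_{h ∈ H} d(α h, β h)`. -/
abbrev HomSpace (H G : Type*) [Group H] [Group G] : Type _ :=
  {f : H → G // ∀ a b : H, f (a * b) = f a * f b}

/-- The equivalence relation on `HomSpace H G` identifying two homomorphisms that are
conjugate by an element of `G`; its classes are the conjugation orbits. -/
def conjSetoid (H G : Type*) [Group H] [Group G] : Setoid (HomSpace H G) where
  r α β := ∃ u : G, ∀ h : H, u * α.1 h * u⁻¹ = β.1 h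
  iseqv := by
    constructor
    · intro α
      exact ⟨1, fun h => by group⟩
    · rintro α β ⟨u, hu⟩
      refine ⟨u⁻¹, fun h => ?_⟩
      rw [← hu h]; group
    · rintro α β γ ⟨u, hu⟩ ⟨v, hv⟩
      refine ⟨v * u, fun h => ?_⟩
      rw [← hv h, ← hu h]; group

section CStarAlgebra

variable {A : Type*} [CStarAlgebra A]

/-- The polar part of an invertible intertwiner of two families of unitaries is a unitary
intertwiner of the same families. -/
theorem exists_unitary_intertwiner_of_isUnit [PartialOrder A] [StarOrderedRing A]
    {ι : Type*} {a b : ι → unitary A} {t : A} (ht : IsUnit t)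
    (h : ∀ i, t * (a i : A) = b i * t) :
    ∃ u : unitary A, ∀ i, u * a i * u⁻¹ = b i := by
  have hstar (i : ι) : star t * (b i : A) = a i * star t := by
    have h₁ : star t * star (b i : A) = star (a i : A) * star t := by
      simpa using congrArg star (h i).symm
    calc star t * (b i : A)
        = (a i * star (a i : A)) * star t * b i := by simp
      _ = a i * (star t * star (b i : A)) * b i := by rw [h₁]; simp only [mul_assoc]
      _ = a i * star t := by simp [mul_assoc]
  have hu : IsUnit (star t * t) := ht.star.mul ht
  obtain ⟨s, hs⟩ : IsUnit (CFC.sqrt (star t * t)) := (CFC.isUnit_sqrt_iff _).2 hu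
  have hss : (s : A) * s = star t * t := by
    rw [hs]; exact CFC.sqrt_mul_sqrt_self _ (star_mul_self_nonneg t)
  have hsa : star (s : A) = s := by
    rw [hs]; exact (IsSelfAdjoint.of_nonneg (CFC.sqrt_nonneg _)).star_eq
  have hsinv : star (↑s⁻¹ : A) = ↑s⁻¹ := by
    have : star s = s := Units.ext hsa
    rw [← Units.coe_star_inv, this]
  have hcomm (i : ι) : Commute (a i : A) s := by
    have hc : Commute (star t * t) (a i : A) := by
      show star t * t * (a i : A) = a i * (star t * t)
      rw [mul_assoc, h, ← mul_assoc, hstar, mul_assoc]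
    rw [hs]
    exact (hc.cfcₙ_nnreal _).symm
  have hmem₁ : star (t * ↑s⁻¹) * (t * ↑s⁻¹) = 1 := by
    rw [star_mul, hsinv, mul_assoc, ← mul_assoc (star t), ← hss]
    simp
  have hmem : t * (↑s⁻¹ : A) ∈ unitary A := by
    refine Unitary.mem_iff.2 ⟨hmem₁, ?_⟩
    exact (ht.mul s⁻¹.isUnit).mul_right_cancel (by rw [mul_assoc, hmem₁, mul_one, one_mul])
  refine ⟨⟨_, hmem⟩, fun i => ?_⟩
  rw [mul_inv_eq_iff_eq_mul]
  ext
  show t * (↑s⁻¹ : A) * a i = b i * (t * ↑s⁻¹)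
  rw [mul_assoc, ← (hcomm i).units_inv_right.eq, ← mul_assoc, h, mul_assoc]

/-- Two unitary-valued multiplicative maps on a finite group at pointwise distance less than `1`
are conjugate by a unitary. -/
theorem exists_unitary_conj_of_norm_sub_lt_one [PartialOrder A] [StarOrderedRing A]
    {H : Type*} [Group H] [Finite H] (α β : HomSpace H (unitary A))
    (hαβ : ∀ h, ‖(α.1 h : A) - β.1 h‖ < 1) :
    ∃ u : unitary A, ∀ h, u * α.1 h * u⁻¹ = β.1 h := by
  have := Fintype.ofFinite H
  set N : ℂ := (Fintype.card H : ℂ) with hN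
  have hN0 : N ≠ 0 := by simp [hN]
  set T : A := ∑ h, (β.1 h : A) * star (α.1 h : A) with hT
  refine exists_unitary_intertwiner_of_isUnit (t := N⁻¹ • T) ?_ fun g => ?_
  · have hsub : (1 : A) - N⁻¹ • T = N⁻¹ • ∑ h, ((α.1 h : A) - β.1 h) * star (α.1 h : A) := by
      have : ∑ h, ((α.1 h : A) - β.1 h) * star (α.1 h : A) = N • (1 : A) - T := by
        simp [sub_mul, hT, hN, Nat.cast_smul_eq_nsmul]
      rw [this, smul_sub, inv_smul_smul₀ hN0]
    have hsum : ‖∑ h, ((α.1 h : A) - β.1 h) * star (α.1 h : A)‖ < Fintype.card H :=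
      calc _ ≤ ∑ h, ‖((α.1 h : A) - β.1 h) * star (α.1 h : A)‖ := norm_sum_le _ _
        _ = ∑ h, ‖(α.1 h : A) - β.1 h‖ := by
          refine Finset.sum_congr rfl fun h _ => ?_
          exact CStarRing.norm_mul_coe_unitary _ (star (α.1 h))
        _ < ∑ _h : H, (1 : ℝ) :=
          Finset.sum_lt_sum_of_nonempty Finset.univ_nonempty fun h _ => hαβ h
        _ = Fintype.card H := by simp
    have hlt : ‖(1 : A) - N⁻¹ • T‖ < 1 := by
      rw [hsub, norm_smul, norm_inv, hN, Complex.norm_natCast, inv_mul_lt_iff₀, mul_one]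
      · exact hsum
      · exact_mod_cast Fintype.card_pos
    simpa using isUnit_one_sub_of_norm_lt_one hlt
  · rw [smul_mul_assoc, mul_smul_comm]
    congr 1
    rw [hT, Finset.sum_mul, Finset.mul_sum]
    refine (Fintype.sum_equiv (Equiv.mulLeft g) _ _ fun h => ?_).symm
    simp [α.2, β.2, mul_assoc]

/-- The conjugation orbit is a locally constant function on the space of unitary homomorphisms of
a finite group. -/
theorem isLocallyConstant_conjSetoid_mk [PartialOrder A] [StarOrderedRing A]
    {H : Type*} [Group H] [Finite H] :
    IsLocallyConstant (Quotient.mk (conjSetoid H (unitary A))) := by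
  refine (IsLocallyConstant.iff_eventually_eq _).2 fun α => ?_
  have hev : ∀ᶠ β : HomSpace H (unitary A) in nhds α,
      ∀ h, ‖(β.1 h : A) - α.1 h‖ < 1 := by
    refine Filter.eventually_all.2 fun h => ?_
    have hc : Continuous fun β : HomSpace H (unitary A) => ‖(β.1 h : A) - α.1 h‖ :=
      ((continuous_subtype_val.comp ((continuous_apply h).comp continuous_subtype_val)).sub
        continuous_const).norm
    exact hc.continuousAt.eventually_lt_const (by simp)
  filter_upwards [hev] with β hβ
  exact Quotient.sound (exists_unitary_conj_of_norm_sub_lt_one β α hβ)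

end CStarAlgebra

/-- A space is homeomorphic to the disjoint union of the fibres of a locally constant function. -/
def IsLocallyConstant.homeomorphSigmaFiber {X Y : Type*} [TopologicalSpace X] {f : X → Y}
    (hf : IsLocallyConstant f) : X ≃ₜ Σ y, {x // f x = y} :=
  ((Equiv.sigmaFiberEquiv f).toHomeomorphOfContinuousOpen
    (continuous_sigma fun _ => continuous_subtype_val)
    (isOpenMap_sigma.2 fun y => (hf.isOpen_fiber y).isOpenMap_subtype_val)).symm

/-- Let `H` be a finite group and `𝓗` a separable complex Hilbert space;
equip the space of homomorphisms `Hom(H, U(𝓗))` with the supremum metric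
`d(α,β) = max_h ‖α h − β h‖` (operator norm), whose topology is the subspace topology of
the product used below.  Then:
(i) two homomorphisms in distinct conjugation orbits of `U(𝓗)` are at distance at least
    `1/|H|`;
(ii) each conjugation orbit is both open and closed in `Hom(H, U(𝓗))`;
(iii) `Hom(H, U(𝓗))` is homeomorphic to the disjoint union of its conjugation orbits. -/
theorem homSpace_unitary_disjoint_union_of_orbits
    {𝓗 : Type*} [NormedAddCommGroup 𝓗] [InnerProductSpace ℂ 𝓗] [CompleteSpace 𝓗]
    [TopologicalSpace.SeparableSpace 𝓗]
    {H : Type*} [Group H] [Finite H] :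
    (∀ α β : HomSpace H (unitary (𝓗 →L[ℂ] 𝓗)),
      ¬ (∃ u : unitary (𝓗 →L[ℂ] 𝓗), ∀ h : H, u * α.1 h * u⁻¹ = β.1 h) →
      (1 : ℝ) / (Nat.card H : ℝ) ≤
        ⨆ h : H, ‖((α.1 h : 𝓗 →L[ℂ] 𝓗)) - ((β.1 h : 𝓗 →L[ℂ] 𝓗))‖) ∧
    (∀ α : HomSpace H (unitary (𝓗 →L[ℂ] 𝓗)),
      IsOpen {β : HomSpace H (unitary (𝓗 →L[ℂ] 𝓗)) |
          ∃ u : unitary (𝓗 →L[ℂ] 𝓗), ∀ h : H, u * α.1 h * u⁻¹ = β.1 h} ∧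
      IsClosed {β : HomSpace H (unitary (𝓗 →L[ℂ] 𝓗)) |
          ∃ u : unitary (𝓗 →L[ℂ] 𝓗), ∀ h : H, u * α.1 h * u⁻¹ = β.1 h}) ∧
    ∃ e : HomSpace H (unitary (𝓗 →L[ℂ] 𝓗)) ≃ₜ
        (Σ o : Quotient (conjSetoid H (unitary (𝓗 →L[ℂ] 𝓗))),
          {β : HomSpace H (unitary (𝓗 →L[ℂ] 𝓗)) //
            Quotient.mk (conjSetoid H (unitary (𝓗 →L[ℂ] 𝓗))) β = o}),
      ∀ β : HomSpace H (unitary (𝓗 →L[ℂ] 𝓗)),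
        e β = ⟨Quotient.mk (conjSetoid H (unitary (𝓗 →L[ℂ] 𝓗))) β, β, rfl⟩ := by
  refine ⟨fun α β hαβ => ?_, fun α => ?_,
    isLocallyConstant_conjSetoid_mk.homeomorphSigmaFiber, fun β => rfl⟩
  · by_contra! hlt
    refine hαβ (exists_unitary_conj_of_norm_sub_lt_one α β fun h => ?_)
    have hcard : (1 : ℝ) / Nat.card H ≤ 1 :=
      div_le_one_of_le₀ (by exact_mod_cast Nat.card_pos) (Nat.cast_nonneg _)
    exact ((le_ciSup (Set.finite_range _).bddAbove h).trans_lt hlt).trans_le hcard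
  · have horbit : {β : HomSpace H (unitary (𝓗 →L[ℂ] 𝓗)) |
        ∃ u : unitary (𝓗 →L[ℂ] 𝓗), ∀ h : H, u * α.1 h * u⁻¹ = β.1 h} =
        {β | Quotient.mk (conjSetoid H (unitary (𝓗 →L[ℂ] 𝓗))) β = Quotient.mk _ α} := by
      ext β
      exact (Quotient.eq (r := conjSetoid H _)).symm.trans eq_comm
    rw [horbit]
    exact (isLocallyConstant_conjSetoid_mk.isClopen_fiber _).symm
end

section
/- Let ℋ be a separable complex Hilbert space and let ρ : S¹ → U(ℋ) be the continuous homomorphism sending λ to the scalar operator λ·id_ℋ. If β : S¹ → U(ℋ) is any continuous group homomorphism (with U(ℋ) carrying the operator-norm topology) satisfying ‖ρ(λ) − β(λ)‖ ≤ 1 for all λ ∈ S¹, then β = ρ. In particular, ρ is an isolated point of the space of continuous homomorphisms S¹ → U(ℋ) with the topology of uniform convergence. -/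
noncomputable section

/-- The homomorphism `ρ : S¹ → U(𝓗)` sending `λ` to the scalar unitary `λ • id`. -/
def scalarHom (𝓗 : Type*) [NormedAddCommGroup 𝓗] [InnerProductSpace ℂ 𝓗]
    [CompleteSpace 𝓗] : Circle →* unitary (𝓗 →L[ℂ] 𝓗) where
  toFun z := ⟨(z : ℂ) • 1, by
    have hstar : star ((z : ℂ) • (1 : 𝓗 →L[ℂ] 𝓗)) = ((z⁻¹ : Circle) : ℂ) • 1 := by
      rw [star_smul, star_one, Complex.star_def, ← Circle.coe_inv_eq_conj]
    constructor
    · rw [hstar, smul_mul_smul_comm, one_mul, ← Circle.coe_mul, inv_mul_cancel,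
        Circle.coe_one, one_smul]
    · rw [hstar, smul_mul_smul_comm, one_mul, ← Circle.coe_mul, mul_inv_cancel,
        Circle.coe_one, one_smul]⟩
  map_one' := Subtype.ext <| by
    show ((1 : Circle) : ℂ) • (1 : 𝓗 →L[ℂ] 𝓗) = ((1 : unitary (𝓗 →L[ℂ] 𝓗)) : 𝓗 →L[ℂ] 𝓗)
    rw [Circle.coe_one, one_smul]; rfl
  map_mul' z w := Subtype.ext <| by
    show ((z * w : Circle) : ℂ) • (1 : 𝓗 →L[ℂ] 𝓗) = ((z : ℂ) • 1) * ((w : ℂ) • 1)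
    rw [Circle.coe_mul, smul_mul_smul_comm, one_mul]

/-- `ρ : S¹ → U(𝓗)` as a continuous monoid homomorphism; the space
`ContinuousMonoidHom Circle (unitary (𝓗 →L[ℂ] 𝓗))` carries the compact-open topology,
which (as `S¹` is compact and `U(𝓗)` metrizable) is the topology of uniform
convergence. -/
def scalarCHom (𝓗 : Type*) [NormedAddCommGroup 𝓗] [InnerProductSpace ℂ 𝓗]
    [CompleteSpace 𝓗] : ContinuousMonoidHom Circle (unitary (𝓗 →L[ℂ] 𝓗)) :=
  ⟨scalarHom 𝓗, Continuous.subtype_mk (continuous_subtype_val.smul continuous_const) _⟩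

/-- If `‖1 - u‖ ≤ 1` for a unitary `u`, then `1 - u ^ 2` expands every vector at least `√3` times
as much as `1 - u` does. -/
theorem three_mul_norm_sq_le_of_unitary {𝓗 : Type*} [NormedAddCommGroup 𝓗]
    [InnerProductSpace ℂ 𝓗] [CompleteSpace 𝓗] (u : unitary (𝓗 →L[ℂ] 𝓗))
    (hu : ‖(1 : 𝓗 →L[ℂ] 𝓗) - (u : 𝓗 →L[ℂ] 𝓗)‖ ≤ 1) (v : 𝓗) :
    3 * ‖v - (u : 𝓗 →L[ℂ] 𝓗) v‖ ^ 2 ≤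
      ‖v - ((u ^ 2 : unitary (𝓗 →L[ℂ] 𝓗)) : 𝓗 →L[ℂ] 𝓗) v‖ ^ 2 := by
  set w := v - (u : 𝓗 →L[ℂ] 𝓗) v with hw
  have hsq : v - ((u ^ 2 : unitary (𝓗 →L[ℂ] 𝓗)) : 𝓗 →L[ℂ] 𝓗) v = w + (u : 𝓗 →L[ℂ] 𝓗) w := by
    simp [hw, pow_two]
  have hpar := parallelogram_law_with_norm ℂ w ((u : 𝓗 →L[ℂ] 𝓗) w)
  have hnorm : ‖(u : 𝓗 →L[ℂ] 𝓗) w‖ = ‖w‖ := Unitary.norm_map u w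
  have hle : ‖w - (u : 𝓗 →L[ℂ] 𝓗) w‖ ≤ ‖w‖ := by
    simpa using ((1 : 𝓗 →L[ℂ] 𝓗) - (u : 𝓗 →L[ℂ] 𝓗)).le_of_opNorm_le hu w
  rw [hnorm] at hpar
  rw [hsq]
  nlinarith [norm_nonneg (w - (u : 𝓗 →L[ℂ] 𝓗) w), norm_nonneg w]

/-- A unitary all of whose powers lie within distance `1` of the identity is the identity. -/
theorem unitary_eq_one_of_norm_one_sub_pow_le_one {𝓗 : Type*} [NormedAddCommGroup 𝓗]
    [InnerProductSpace ℂ 𝓗] [CompleteSpace 𝓗] (u : unitary (𝓗 →L[ℂ] 𝓗))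
    (hu : ∀ n : ℕ, ‖(1 : 𝓗 →L[ℂ] 𝓗) - ((u ^ n : unitary (𝓗 →L[ℂ] 𝓗)) : 𝓗 →L[ℂ] 𝓗)‖ ≤ 1) :
    u = 1 := by
  refine Subtype.ext (ContinuousLinearMap.ext fun v => ?_)
  have hgrow : ∀ k : ℕ, 3 ^ k * ‖v - (u : 𝓗 →L[ℂ] 𝓗) v‖ ^ 2 ≤
      ‖v - ((u ^ 2 ^ k : unitary (𝓗 →L[ℂ] 𝓗)) : 𝓗 →L[ℂ] 𝓗) v‖ ^ 2 := by
    intro k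
    induction k with
    | zero => simp
    | succ k ih =>
      have h := three_mul_norm_sq_le_of_unitary (u ^ 2 ^ k) (hu _) v
      rw [← pow_mul, ← pow_succ] at h
      rw [pow_succ]
      linarith
  have hbound : ∀ k : ℕ, 3 ^ k * ‖v - (u : 𝓗 →L[ℂ] 𝓗) v‖ ^ 2 ≤ ‖v‖ ^ 2 := by
    intro k
    have hle : ‖v - ((u ^ 2 ^ k : unitary (𝓗 →L[ℂ] 𝓗)) : 𝓗 →L[ℂ] 𝓗) v‖ ≤ ‖v‖ := by
      simpa using ContinuousLinearMap.le_of_opNorm_le _ (hu (2 ^ k)) v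
    exact (hgrow k).trans (by gcongr)
  have hzero : ‖v - (u : 𝓗 →L[ℂ] 𝓗) v‖ ^ 2 ≤ 0 := by
    by_contra! hpos
    obtain ⟨k, hk⟩ := pow_unbounded_of_one_lt (‖v‖ ^ 2 / ‖v - (u : 𝓗 →L[ℂ] 𝓗) v‖ ^ 2)
      (by norm_num : (1 : ℝ) < 3)
    rw [div_lt_iff₀ hpos] at hk
    exact (hbound k).not_gt hk
  have hnorm : ‖v - (u : 𝓗 →L[ℂ] 𝓗) v‖ = 0 :=
    pow_eq_zero_iff two_ne_zero |>.mp (hzero.antisymm (sq_nonneg _))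
  exact (sub_eq_zero.mp (norm_eq_zero.mp hnorm)).symm

/-- Scalar unitaries commute with every unitary. -/
theorem commute_scalarHom {𝓗 : Type*} [NormedAddCommGroup 𝓗] [InnerProductSpace ℂ 𝓗]
    [CompleteSpace 𝓗] (z : Circle) (u : unitary (𝓗 →L[ℂ] 𝓗)) : Commute (scalarHom 𝓗 z) u :=
  Subtype.ext <| by
    change ((z : ℂ) • (1 : 𝓗 →L[ℂ] 𝓗)) * (u : 𝓗 →L[ℂ] 𝓗) =
      (u : 𝓗 →L[ℂ] 𝓗) * ((z : ℂ) • (1 : 𝓗 →L[ℂ] 𝓗))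
    rw [smul_mul_assoc, mul_smul_comm, one_mul, mul_one]

/-- A homomorphism within uniform distance `1` of the scalar homomorphism equals it. -/
theorem eq_scalarHom_of_norm_sub_le_one {𝓗 : Type*} [NormedAddCommGroup 𝓗]
    [InnerProductSpace ℂ 𝓗] [CompleteSpace 𝓗] (β : Circle →* unitary (𝓗 →L[ℂ] 𝓗))
    (hβ : ∀ z : Circle,
      ‖((scalarHom 𝓗 z : 𝓗 →L[ℂ] 𝓗)) - ((β z : 𝓗 →L[ℂ] 𝓗))‖ ≤ 1) :
    β = scalarHom 𝓗 := by
  ext1 z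
  refine (inv_mul_eq_one.mp (unitary_eq_one_of_norm_one_sub_pow_le_one
    ((scalarHom 𝓗 z)⁻¹ * β z) fun n => ?_)).symm
  have hpow : ((scalarHom 𝓗 z)⁻¹ * β z) ^ n = (scalarHom 𝓗 (z ^ n))⁻¹ * β (z ^ n) := by
    rw [(commute_scalarHom z (β z)).inv_left.mul_pow, map_pow, map_pow, inv_pow]
  have hfactor : (1 : 𝓗 →L[ℂ] 𝓗) -
      (((scalarHom 𝓗 (z ^ n))⁻¹ * β (z ^ n) : unitary (𝓗 →L[ℂ] 𝓗)) : 𝓗 →L[ℂ] 𝓗) =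
      ((scalarHom 𝓗 (z ^ n))⁻¹ : unitary (𝓗 →L[ℂ] 𝓗)) *
        ((scalarHom 𝓗 (z ^ n) : 𝓗 →L[ℂ] 𝓗) - (β (z ^ n) : 𝓗 →L[ℂ] 𝓗)) := by
    rw [mul_sub, ← Submonoid.coe_mul, ← Submonoid.coe_mul, inv_mul_cancel, Submonoid.coe_one]
  rw [hpow, hfactor, CStarRing.norm_coe_unitary_mul]
  exact hβ (z ^ n)

/-- Let `𝓗` be a separable complex Hilbert space and `ρ : S¹ → U(𝓗)` the
homomorphism `λ ↦ λ • id`.  If `β : S¹ → U(𝓗)` is a continuous homomorphism with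
`‖ρ(λ) − β(λ)‖ ≤ 1` for all `λ` (operator norm), then `β = ρ`; in particular `ρ` is an
isolated point of the space of continuous homomorphisms `S¹ → U(𝓗)` with the topology of
uniform convergence. -/
theorem scalarHom_isolated
    {𝓗 : Type*} [NormedAddCommGroup 𝓗] [InnerProductSpace ℂ 𝓗] [CompleteSpace 𝓗]
    [TopologicalSpace.SeparableSpace 𝓗] :
    (∀ β : Circle →* unitary (𝓗 →L[ℂ] 𝓗), Continuous β →
      (∀ z : Circle, ‖((scalarHom 𝓗 z : 𝓗 →L[ℂ] 𝓗)) - ((β z : 𝓗 →L[ℂ] 𝓗))‖ ≤ 1) →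
      β = scalarHom 𝓗) ∧
    IsOpen ({scalarCHom 𝓗} :
      Set (ContinuousMonoidHom Circle (unitary (𝓗 →L[ℂ] 𝓗)))) := by
  refine ⟨fun β _ hβ => eq_scalarHom_of_norm_sub_le_one β hβ, ?_⟩
  have hpre : ({scalarCHom 𝓗} : Set (ContinuousMonoidHom Circle (unitary (𝓗 →L[ℂ] 𝓗)))) =
      ContinuousMonoidHom.toContinuousMap ⁻¹'
        Metric.ball (scalarCHom 𝓗).toContinuousMap 1 := by
    ext β
    refine ⟨fun h => ?_, fun h => ?_⟩
    · rw [Set.mem_singleton_iff.mp h]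
      exact Metric.mem_ball_self one_pos
    · have hβ : β.toMonoidHom = scalarHom 𝓗 := by
        refine eq_scalarHom_of_norm_sub_le_one _ fun z => ?_
        have hdist := (ContinuousMap.dist_apply_le_dist (f := β.toContinuousMap)
          (g := (scalarCHom 𝓗).toContinuousMap) z).trans (Metric.mem_ball.mp h).le
        rw [dist_comm, Subtype.dist_eq, dist_eq_norm] at hdist
        exact hdist
      exact ContinuousMonoidHom.ext fun z => DFunLike.congr_fun hβ z
  rw [hpre]
  exact Metric.isOpen_ball.preimage
    (ContinuousMonoidHom.isInducing_toContinuousMap Circle (unitary (𝓗 →L[ℂ] 𝓗))).continuous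
end
end

section
/- Let p : X → Y be a surjective quotient map of topological spaces and let Z be a Hausdorff space. Then the induced map p* : C(Y,Z) → C(X,Z), f ↦ f ∘ p, is a continuous injection whose image is a closed subset of C(X,Z), where both mapping spaces carry the compact-open topology. -/
/-- The maps `X → Z` that factor through a quotient map `p : X → Y` are those which are constant on
the fibres of `p`. -/
theorem range_comp_quotientMap {X Y Z : Type*} [TopologicalSpace X] [TopologicalSpace Y]
    [TopologicalSpace Z] (p : C(X, Y)) (hquot : Topology.IsQuotientMap (⇑p)) :
    Set.range (fun f : C(Y, Z) => f.comp p) =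
      {g : C(X, Z) | ∀ a b, p a = p b → g a = g b} := by
  ext g
  constructor
  · rintro ⟨f, rfl⟩ a b hab
    exact congrArg f hab
  · intro hg
    exact ⟨hquot.lift g hg, hquot.lift_comp g hg⟩

/-- Let `p : X → Y` be a surjective quotient map of topological spaces
and `Z` a Hausdorff space.  Then the induced map `p* : C(Y,Z) → C(X,Z)`, `f ↦ f ∘ p`, is a
continuous injection whose image is closed, where both mapping spaces carry the
compact-open topology. -/
theorem comp_quotientMap_continuous_injective_closedRange
    {X Y Z : Type*} [TopologicalSpace X] [TopologicalSpace Y] [TopologicalSpace Z]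
    [T2Space Z] (p : C(X, Y)) (hsurj : Function.Surjective p)
    (hquot : Topology.IsQuotientMap (⇑p)) :
    Continuous (fun f : C(Y, Z) => f.comp p) ∧
    Function.Injective (fun f : C(Y, Z) => f.comp p) ∧
    IsClosed (Set.range (fun f : C(Y, Z) => f.comp p)) := by
  refine ⟨ContinuousMap.continuous_precomp p, fun f g hfg => ?_, ?_⟩
  · ext y
    obtain ⟨x, rfl⟩ := hsurj y
    exact DFunLike.congr_fun hfg x
  · rw [range_comp_quotientMap p hquot]
    simp only [Set.ofPred_forall]
    exact isClosed_iInter fun a => isClosed_iInter fun b => isClosed_iInter fun _ =>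
      isClosed_eq (continuous_eval_const a) (continuous_eval_const b)
end
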